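/- Second product rule in B^0_{∞,2}: For every ε > 0 there exists a constant C_ε > 0 such that for vector fields u, v on 𝕋^d, ‖u·∇v‖_{B^0_{∞,2}} ≤ C_ε ‖u‖_{B^0_{∞,2}} ‖v‖_{B^{1+ε}_{∞,2}}. -/

import Mathlib

open MeasureTheory Complex
open scoped BigOperators ENNReal NNReal

noncomputable section

/-! ## A Fourier-analytic framework for distributions on the torus `𝕋^d`

A distribution on `𝕋^d` is represented by its sequence of Fourier coefficients,
a function `(Fin d → ℤ) → E` (with `E = ℂ` for scalar functions, `E = Fin d → ℂ`
for vector fields, etc.).  All operators (Littlewood–Paley blocks, Leray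
projection, advection, Laplacian, ...) are defined on the Fourier side, and `L^p`
norms are computed from the realization as a (periodic) function on the cube. -/

/-- Euclidean norm of a lattice frequency. -/
def znorm {d : ℕ} (k : Fin d → ℤ) : ℝ := Real.sqrt (∑ i, ((k i : ℝ)) ^ 2)

/-- Squared Euclidean norm of a lattice frequency. -/
def znorm2 {d : ℕ} (k : Fin d → ℤ) : ℤ := ∑ i, (k i) ^ 2

/-- The character `e^{2πik·x}`. -/
def fChar {d : ℕ} (k : Fin d → ℤ) (x : Fin d → ℝ) : ℂ :=
  Complex.exp (((2 * Real.pi * ∑ i, (k i : ℝ) * x i : ℝ) : ℂ) * Complex.I)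

variable {d : ℕ} {E : Type*}

/-- Realization of a Fourier coefficient sequence as a (periodic) function on `ℝ^d`. -/
def realize [NormedAddCommGroup E] [NormedSpace ℂ E] (a : (Fin d → ℤ) → E) :
    (Fin d → ℝ) → E :=
  fun x => ∑' k, fChar k x • a k

/-- The fundamental cube of the torus, as a measure on `ℝ^d`. -/
def μT (d : ℕ) : Measure (Fin d → ℝ) := volume.restrict (Set.Icc 0 1)

/-- The `L^p` norm over the torus of (the realization of) a coefficient sequence. -/
def tLp [NormedAddCommGroup E] [NormedSpace ℂ E] (p : ℝ≥0∞) (a : (Fin d → ℤ) → E) :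
    ℝ≥0∞ :=
  eLpNorm (realize a) p (μT d)

/-- A smooth monotone Littlewood–Paley cutoff function `χ` as in the paper:
`χ : [0,∞) → [0,1]`, `χ ≡ 1` on `[0,1/2]`, `χ(3/4) = 1/2`, `χ ≡ 0` on `[1,∞)`. -/
structure Cutoff where
  χ : ℝ → ℝ
  smooth : ContDiff ℝ (⊤ : ℕ∞) χ
  mono : AntitoneOn χ (Set.Ici 0)
  nonneg : ∀ x, 0 ≤ χ x
  le_one : ∀ x, χ x ≤ 1
  eq_one : ∀ x ∈ Set.Icc (0 : ℝ) (1 / 2), χ x = 1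
  eq_half : χ (3 / 4) = 1 / 2
  eq_zero : ∀ x, (1 : ℝ) ≤ x → χ x = 0

/-- The symbol of the Littlewood–Paley block `Δ_j`:
`χ(t)` for `j = 0` and `φ(t/2^j) = χ(t/2^j) − χ(t/2^{j-1})` for `j ≥ 1`. -/
def lpSymb (c : Cutoff) : ℕ → ℝ → ℝ
  | 0, t => c.χ t
  | j + 1, t => c.χ (t / 2 ^ (j + 1)) - c.χ (t / 2 ^ j)

/-- The Littlewood–Paley block `Δ_j`, acting on Fourier coefficients. -/
def blockC [NormedAddCommGroup E] [NormedSpace ℂ E] (c : Cutoff) (j : ℕ)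
    (a : (Fin d → ℤ) → E) : (Fin d → ℤ) → E :=
  fun k => ((lpSymb c j (znorm k) : ℝ) : ℂ) • a k

/-- The low-frequency cutoff `S_j = Δ_0 + Δ_1 + ⋯ + Δ_j`, acting on Fourier coefficients. -/
def lowC [NormedAddCommGroup E] [NormedSpace ℂ E] (c : Cutoff) (j : ℕ)
    (a : (Fin d → ℤ) → E) : (Fin d → ℤ) → E :=
  fun k => ((∑ l ∈ Finset.range (j + 1), lpSymb c l (znorm k) : ℝ) : ℂ) • a k

/-- The `ℓ^r` norm (`r ∈ [1,∞]`) of a sequence of extended nonnegative reals. -/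
def lr (r : ℝ≥0∞) (a : ℕ → ℝ≥0∞) : ℝ≥0∞ :=
  if r = ∞ then ⨆ j, a j else (∑' j, a j ^ r.toReal) ^ (1 / r.toReal)

/-- The inhomogeneous Besov norm `‖·‖_{B^s_{p,r}}` on the torus:
the `ℓ^r` norm of `j ↦ 2^{js} ‖Δ_j a‖_{L^p}`. -/
def besov [NormedAddCommGroup E] [NormedSpace ℂ E] (c : Cutoff) (s : ℝ) (p r : ℝ≥0∞)
    (a : (Fin d → ℤ) → E) : ℝ≥0∞ :=
  lr r fun j => (2 : ℝ≥0∞) ^ ((j : ℝ) * s) * tLp p (blockC c j a)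

/-- Rapid decay of Fourier coefficients: the represented distribution is smooth. -/
def SmoothCoeff [NormedAddCommGroup E] (a : (Fin d → ℤ) → E) : Prop :=
  ∀ n : ℕ, ∃ C : ℝ, ∀ k, ‖a k‖ * (1 + znorm k) ^ n ≤ C

/-- The Fourier multiplier `Λ^s = (-Δ)^{s/2}` with symbol `|k|^s`. -/
def lambdaPow [NormedAddCommGroup E] [NormedSpace ℂ E] (s : ℝ) (a : (Fin d → ℤ) → E) :
    (Fin d → ℤ) → E :=
  fun k => ((znorm k ^ s : ℝ) : ℂ) • a k

/-- Fourier coefficients of the pointwise product of a scalar function with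
coefficients `a` and an `E`-valued function with coefficients `b` (convolution). -/
def convC [NormedAddCommGroup E] [NormedSpace ℂ E] (a : (Fin d → ℤ) → ℂ)
    (b : (Fin d → ℤ) → E) : (Fin d → ℤ) → E :=
  fun k => ∑' m, a m • b (k - m)

/-- The Bony paraproduct `T_u v = Σ_{j≥1} S_{j−1}u Δ_j v`, on Fourier coefficients. -/
def para (c : Cutoff) (u v : (Fin d → ℤ) → ℂ) : (Fin d → ℤ) → ℂ :=
  fun k => ∑' j : ℕ, convC (lowC c j u) (blockC c (j + 1) v) k

/-- The Bony remainder `R(u,v) = Σ_{|j−l|≤1} Δ_j u Δ_l v`, on Fourier coefficients. -/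
def remainder (c : Cutoff) (u v : (Fin d → ℤ) → ℂ) : (Fin d → ℤ) → ℂ :=
  fun k => ∑' j : ℕ, ∑' l : ℕ,
    if ((j : ℤ) - l).natAbs ≤ 1 then convC (blockC c j u) (blockC c l v) k else 0

/-- Fourier coefficients of a vector field on `𝕋^d`. -/
abbrev VC (d : ℕ) := (Fin d → ℤ) → Fin d → ℂ

/-- The divergence-free condition `∇·u = 0`, on Fourier coefficients. -/
def DivFree {d : ℕ} (u : VC d) : Prop := ∀ k, ∑ i, (k i : ℂ) * u k i = 0

/-- Fourier coefficients of the advection term `u·∇v = Σ_l u_l ∂_l v`. -/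
def advect {d : ℕ} (u v : VC d) : VC d :=
  fun k i => ∑' m : Fin d → ℤ,
    (∑ l, u m l * (((2 * Real.pi : ℝ) : ℂ) * Complex.I * ((k l - m l : ℤ) : ℂ)))
      * v (k - m) i

/-- The Leray projection `ℙ` onto divergence-free fields, on Fourier coefficients. -/
def leray {d : ℕ} (v : VC d) : VC d :=
  fun k i => if k = 0 then v k i
    else v k i - ((∑ l, (k l : ℂ) * v k l) / ((znorm2 k : ℤ) : ℂ)) * (k i : ℂ)

/-- Fourier coefficients of the Laplacian `Δ`. -/
def lapC [NormedAddCommGroup E] [NormedSpace ℂ E] (a : (Fin d → ℤ) → E) :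
    (Fin d → ℤ) → E :=
  fun k => ((-(4 * Real.pi ^ 2 * ((znorm2 k : ℤ) : ℝ)) : ℝ) : ℂ) • a k

/-- Fourier coefficients of the gradient `∇q` of a scalar function. -/
def gradC {d : ℕ} (q : (Fin d → ℤ) → ℂ) : VC d :=
  fun k i => ((2 * Real.pi : ℝ) : ℂ) * Complex.I * ((k i : ℤ) : ℂ) * q k

/-- Fourier coefficients of the full gradient `∇u` (a matrix field) of a vector field. -/
def gradM {d : ℕ} (u : VC d) : (Fin d → ℤ) → Fin d → Fin d → ℂ :=
  fun k i l => ((2 * Real.pi : ℝ) : ℂ) * Complex.I * ((k l : ℤ) : ℂ) * u k i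

/-- Fourier coefficients of the divergence `∇·w` of a vector field. -/
def divC {d : ℕ} (w : VC d) : (Fin d → ℤ) → ℂ :=
  fun k => ((2 * Real.pi : ℝ) : ℂ) * Complex.I * ∑ l, (k l : ℂ) * w k l

/-- The inverse `(−Δ)^{−1}` of the negative Laplacian on mean-zero functions. -/
def invNegLap [NormedAddCommGroup E] [NormedSpace ℂ E] (a : (Fin d → ℤ) → E) :
    (Fin d → ℤ) → E :=
  fun k => if k = 0 then 0 else (((4 * Real.pi ^ 2 * ((znorm2 k : ℤ) : ℝ))⁻¹ : ℝ) : ℂ) • a k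

/-- The commutator `I_j = [u·∇, ℙΔ_j] f = u·∇(ℙΔ_j f) − ℙΔ_j (u·∇ f)`. -/
def commJ {d : ℕ} (c : Cutoff) (u f : VC d) (j : ℕ) : VC d :=
  fun k i => advect u (leray (blockC c j f)) k i - leray (blockC c j (advect u f)) k i

/-- `U` (with pressure `P`) solves the incompressible Navier–Stokes equations
`∂_t u + u·∇u + ∇p = νΔu`, `∇·u = 0` on the time interval `[0,T]`, on the Fourier side. -/
def SolvesNS (ν T : ℝ) (U : ℝ → VC 2) (P : ℝ → (Fin 2 → ℤ) → ℂ) : Prop :=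
  (∀ t ∈ Set.Icc (0 : ℝ) T, DivFree (U t)) ∧
  ∀ t ∈ Set.Icc (0 : ℝ) T, ∀ k i,
    HasDerivAt (fun s => U s k i)
      ((ν : ℂ) * lapC (U t) k i - advect (U t) (U t) k i - gradC (P t) k i) t

/-- One step of the semi-implicit scheme
`(u^{n+1} − u^n)/τ + ℙ(u^n·∇u^{n+1}) = νΔu^{n+1}`. -/
def SchemeStep (ν τ : ℝ) (v w : VC 2) : Prop :=
  ∀ k i, (w k i - v k i) / (τ : ℂ) + leray (advect v w) k i = (ν : ℂ) * lapC w k i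

open scoped Classical in
/-- The Fourier truncation `Π_N`, keeping only the frequencies with `1 ≤ |k|_∞ ≤ N`. -/
def truncC {d : ℕ} (N : ℕ) (v : VC d) : VC d :=
  fun k i => if (∀ l, |k l| ≤ (N : ℤ)) ∧ k ≠ 0 then v k i else 0

/-- One step of the fully discrete Fourier spectral semi-implicit scheme
`(u^{n+1} − u^n)/τ + ℙΠ_N(u^n·∇u^{n+1}) = νΔu^{n+1}`. -/
def SchemeStepN (N : ℕ) (ν τ : ℝ) (v w : VC 2) : Prop :=
  ∀ k i, (w k i - v k i) / (τ : ℂ) + leray (truncC N (advect v w)) k i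
    = (ν : ℂ) * lapC w k i


section TrigPolynomials

variable [NormedAddCommGroup E] [NormedSpace ℂ E]

/-- The supremum over `ℝ^d` of the norm of the realization of a coefficient sequence. -/
def supNorm (a : (Fin d → ℤ) → E) : ℝ≥0∞ := ⨆ x, ‖realize a x‖ₑ

theorem enorm_realize_le_supNorm (a : (Fin d → ℤ) → E) (x : Fin d → ℝ) :
    ‖realize a x‖ₑ ≤ supNorm a := le_iSup (fun x => ‖realize a x‖ₑ) x

theorem norm_fChar (k : Fin d → ℤ) (x : Fin d → ℝ) : ‖fChar k x‖ = 1 :=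
  Complex.norm_exp_ofReal_mul_I _

theorem fChar_add_freq (k m : Fin d → ℤ) (x : Fin d → ℝ) :
    fChar (k + m) x = fChar k x * fChar m x := by
  rw [fChar, fChar, fChar, ← Complex.exp_add, ← add_mul, ← Complex.ofReal_add, ← mul_add,
    ← Finset.sum_add_distrib]
  simp [add_mul]

theorem fChar_add (k : Fin d → ℤ) (x y : Fin d → ℝ) :
    fChar k (x + y) = fChar k x * fChar k y := by
  rw [fChar, fChar, fChar, ← Complex.exp_add, ← add_mul, ← Complex.ofReal_add, ← mul_add,
    ← Finset.sum_add_distrib]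
  simp [mul_add]

theorem fChar_intCast (k n : Fin d → ℤ) : fChar k (fun i => (n i : ℝ)) = 1 := by
  rw [fChar, Complex.exp_eq_one_iff]
  exact ⟨∑ i, k i * n i, by push_cast; ring⟩

theorem continuous_fChar (k : Fin d → ℤ) : Continuous (fChar k) := by
  unfold fChar; fun_prop

theorem realize_eq_sum {a : (Fin d → ℤ) → E} {s : Finset (Fin d → ℤ)}
    (hs : Function.support a ⊆ s) (x : Fin d → ℝ) :
    realize a x = ∑ k ∈ s, fChar k x • a k := by
  refine tsum_eq_sum fun k hk => ?_
  rw [Function.notMem_support.1 fun h => hk (hs h), smul_zero]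

theorem continuous_realize {a : (Fin d → ℤ) → E} (ha : (Function.support a).Finite) :
    Continuous (realize a) := by
  rw [funext (realize_eq_sum (s := ha.toFinset) (by simp))]
  exact continuous_finsetSum _ fun k _ => (continuous_fChar k).smul continuous_const

theorem realize_add_intCast (a : (Fin d → ℤ) → E) (x : Fin d → ℝ) (n : Fin d → ℤ) :
    realize a (x + fun i => (n i : ℝ)) = realize a x := by
  simp [realize, fChar_add, fChar_intCast]

theorem tLp_top_eq_supNorm {a : (Fin d → ℤ) → E} (ha : (Function.support a).Finite) :
    tLp ∞ a = supNorm a := by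
  rw [tLp, eLpNorm_exponent_top]
  apply le_antisymm
  · exact eLpNormEssSup_le_of_ae_enorm_bound (.of_forall (enorm_realize_le_supNorm a))
  refine iSup_le fun x => ?_
  have hc : Continuous fun y => ‖realize a y‖ₑ := (continuous_realize ha).enorm
  set M := eLpNormEssSup (realize a) (μT d)
  have hae : ∀ᵐ y ∂μT d, ‖realize a y‖ₑ ≤ M := enorm_ae_le_eLpNormEssSup _ _
  let V : Set (Fin d → ℝ) := Set.univ.pi fun _ => Set.Ioo 0 1
  have hV : IsOpen V := isOpen_set_pi Set.finite_univ fun _ _ => isOpen_Ioo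
  have hVs : V ⊆ Set.Icc 0 1 := fun y hy =>
    ⟨fun i => (hy i trivial).1.le, fun i => (hy i trivial).2.le⟩
  have hsub : V ⊆ {y | ‖realize a y‖ₑ ≤ M} := by
    by_contra hcon
    obtain ⟨y, hyV, hy⟩ := Set.not_subset.1 hcon
    have hopen : IsOpen (V ∩ {y | M < ‖realize a y‖ₑ}) :=
      hV.inter (isOpen_lt continuous_const hc)
    refine hopen.measure_ne_zero volume ⟨y, hyV, lt_of_not_ge (α := ℝ≥0∞) hy⟩ ?_
    rw [μT, ae_restrict_iff' measurableSet_Icc] at hae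
    refine measure_mono_null ?_ hae
    rintro z ⟨hzV, hz⟩ h
    exact absurd (h (hVs hzV)) (not_le.2 hz)
  have hcl : closure V ⊆ {y | ‖realize a y‖ₑ ≤ M} :=
    closure_minimal hsub (isClosed_le hc continuous_const)
  have hx : (fun i => Int.fract (x i)) ∈ closure V := by
    rw [closure_pi_set]
    intro i _
    rw [closure_Ioo zero_ne_one]
    exact ⟨Int.fract_nonneg _, (Int.fract_lt_one _).le⟩
  have := hcl hx
  have hxx : x = (fun i => Int.fract (x i)) + fun i => ((⌊x i⌋ : ℤ) : ℝ) := by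
    ext i; simp [Int.fract_add_floor]
  rw [hxx, realize_add_intCast a _ fun i => ⌊x i⌋]
  exact this

/-- A countable triangle inequality for coefficient sequences. -/
theorem supNorm_le_tsum {ι : Type*} {a : (Fin d → ℤ) → E} {b : ι → (Fin d → ℤ) → E}
    {s : Finset (Fin d → ℤ)} (ha : Function.support a ⊆ s)
    (hb : ∀ n, Function.support (b n) ⊆ s) (h : ∀ k, HasSum (fun n => b n k) (a k)) :
    supNorm a ≤ ∑' n, supNorm (b n) := by
  refine iSup_le fun x => ?_
  have hs : HasSum (fun n => realize (b n) x) (realize a x) := by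
    simp_rw [realize_eq_sum ha, fun n => realize_eq_sum (hb n)]
    exact hasSum_sum fun k _ => (h k).const_smul _
  rw [← hs.tsum_eq]
  exact enorm_tsum_le_tsum_enorm.trans (ENNReal.tsum_le_tsum fun n => enorm_realize_le_supNorm _ x)

end TrigPolynomials

section Bessel

/-- Bessel's inequality for trigonometric polynomials. -/
theorem sum_norm_sq_le_of_bound {a : (Fin d → ℤ) → ℂ} (s : Finset (Fin d → ℤ)) {M : ℝ}
    (hM : ∀ x, ‖∑ k ∈ s, fChar k x • a k‖ ≤ M) : ∑ k ∈ s, ‖a k‖ ^ 2 ≤ M ^ 2 := by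
  let _ : MeasureSpace UnitAddCircle := ⟨AddCircle.haarAddCircle⟩
  have _ : IsProbabilityMeasure (volume : Measure UnitAddCircle) :=
    inferInstanceAs (IsProbabilityMeasure AddCircle.haarAddCircle)
  have ho := UnitAddTorus.orthonormal_mFourier (d := Fin d)
  have hM0 : 0 ≤ M := (norm_nonneg _).trans (hM 0)
  set g : C(UnitAddTorus (Fin d), ℂ) := ∑ k ∈ s, a k • UnitAddTorus.mFourier k with hg
  have hgM : ‖g‖ ≤ M := by
    refine (ContinuousMap.norm_le _ hM0).2 fun y => ?_
    obtain ⟨x, rfl⟩ : ∃ x : Fin d → ℝ, y = fun i => (x i : UnitAddCircle) := by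
      choose x hx using fun i => QuotientAddGroup.mk_surjective (y i)
      exact ⟨x, funext fun i => (hx i).symm⟩
    suffices h : g (fun i => (x i : UnitAddCircle)) = ∑ k ∈ s, fChar k x • a k from h ▸ hM x
    rw [hg, ContinuousMap.coe_sum, Finset.sum_apply]
    refine Finset.sum_congr rfl fun k _ => ?_
    rw [ContinuousMap.smul_apply, smul_eq_mul, smul_eq_mul, mul_comm]
    congr 1
    simp only [UnitAddTorus.mFourier, ContinuousMap.coe_mk, fourier_coe_apply, fChar]
    rw [← Complex.exp_sum]
    congr 1
    push_cast
    rw [Finset.mul_sum, Finset.sum_mul]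
    exact Finset.sum_congr rfl fun i _ => by ring
  set L := ∑ k ∈ s, a k • UnitAddTorus.mFourierLp 2 k with hL
  have hLg : L = ContinuousMap.toLp (E := ℂ) 2 volume ℂ g := by
    rw [hL, hg, map_sum]
    exact Finset.sum_congr rfl fun k _ => by rw [map_smul]
  have hLM : ‖L‖ ≤ M := by
    rw [hLg]
    refine (ContinuousLinearMap.le_opNorm _ _).trans ?_
    refine (mul_le_mul_of_nonneg_right (ContinuousMap.toLp_norm_le _) (norm_nonneg _)).trans ?_
    have hone : measureUnivNNReal (volume : Measure (UnitAddTorus (Fin d))) = 1 := by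
      simp [measureUnivNNReal]
    simpa [hone] using hgM
  have hsq : ∑ k ∈ s, ‖a k‖ ^ 2 = ‖L‖ ^ 2 := by
    have h1 := ho.inner_sum a a s
    rw [← hL, inner_self_eq_norm_sq_to_K] at h1
    have h2 : ((‖L‖ ^ 2 : ℝ) : ℂ) = ((∑ k ∈ s, ‖a k‖ ^ 2 : ℝ) : ℂ) := by
      push_cast
      refine Eq.trans (by simp) (h1.trans ?_)
      exact Finset.sum_congr rfl fun k _ => by rw [Complex.conj_mul']
    exact (Complex.ofReal_injective h2).symm
  rw [hsq]
  gcongr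

end Bessel

section Multipliers

open scoped SchwartzMap FourierTransform

/-- A lattice frequency, seen as a point of Euclidean space. -/
def latticePoint (k : Fin d → ℤ) : EuclideanSpace ℝ (Fin d) := WithLp.toLp 2 fun i => (k i : ℝ)

theorem norm_latticePoint (k : Fin d → ℤ) : ‖latticePoint k‖ = znorm k := by
  simp [latticePoint, znorm, EuclideanSpace.norm_eq]

theorem schwartz_smul_latticePoint (m : 𝓢(EuclideanSpace ℝ (Fin d), ℂ)) (s : ℝ) (k : Fin d → ℤ) :
    m (s • latticePoint k) = ∫ y, fChar k (s • y.ofLp) * 𝓕 m y := by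
  have h : m = 𝓕⁻ (𝓕 m) := by simp
  conv_lhs => rw [h]
  rw [SchwartzMap.fourierInv_coe, Real.fourierInv_eq']
  refine integral_congr_ae (.of_forall fun y => ?_)
  simp only [smul_eq_mul, fChar]
  congr 3
  rw [real_inner_smul_right, PiLp.inner_apply, Finset.mul_sum]
  refine congrArg (fun r : ℝ => ((2 * Real.pi * r : ℝ) : ℂ)) (Finset.sum_congr rfl fun i _ => ?_)
  simp [latticePoint]
  ring

theorem supNorm_multiplier_le [NormedAddCommGroup E] [NormedSpace ℂ E] [CompleteSpace E]
    (m : 𝓢(EuclideanSpace ℝ (Fin d), ℂ)) (s : ℝ) {a : (Fin d → ℤ) → E}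
    (ha : (Function.support a).Finite) :
    supNorm (fun k => m (s • latticePoint k) • a k) ≤ (∫⁻ y, ‖𝓕 m y‖ₑ) * supNorm a := by
  refine iSup_le fun x => ?_
  have hsupp : Function.support (fun k => m (s • latticePoint k) • a k) ⊆ ha.toFinset := by
    intro k hk
    simp only [Function.mem_support, Set.Finite.coe_toFinset] at hk ⊢
    exact fun h => hk (by rw [h, smul_zero])
  have hint (k : Fin d → ℤ) : Integrable fun y => fChar k (s • y.ofLp) * 𝓕 m y := by
    refine (𝓕 m).integrable.bdd_mul (c := 1) ?_ (.of_forall fun y => (norm_fChar _ _).le)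
    exact ((continuous_fChar k).comp (by fun_prop)).aestronglyMeasurable
  have key : realize (fun k => m (s • latticePoint k) • a k) x
      = ∫ y, 𝓕 m y • realize a (x + s • y.ofLp) := by
    rw [realize_eq_sum hsupp]
    simp_rw [schwartz_smul_latticePoint, ← integral_smul_const, ← integral_smul]
    rw [← integral_finsetSum]
    · refine integral_congr_ae (.of_forall fun y => ?_)
      simp only
      rw [realize_eq_sum (s := ha.toFinset) (by simp), Finset.smul_sum]
      refine Finset.sum_congr rfl fun k _ => ?_
      rw [fChar_add, smul_smul, smul_smul]
      congr 1
      ring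
    · exact fun k _ => ((hint k).smul_const _).smul _
  rw [key, ← lintegral_mul_const _ (𝓕 m).continuous.enorm.measurable]
  refine (enorm_integral_le_lintegral_enorm _).trans (lintegral_mono fun y => ?_)
  rw [enorm_smul]
  gcongr
  exact enorm_realize_le_supNorm _ _

theorem lintegral_enorm_fourier_lt_top (m : 𝓢(EuclideanSpace ℝ (Fin d), ℂ)) :
    ∫⁻ y, ‖𝓕 m y‖ₑ < ∞ := (𝓕 m).integrable.2

theorem contDiff_radialCutoff (c : Cutoff) :
    ContDiff ℝ (⊤ : ℕ∞) fun ξ : EuclideanSpace ℝ (Fin d) => ((c.χ ‖ξ‖ : ℝ) : ℂ) := by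
  refine Complex.ofRealCLM.contDiff.comp (contDiff_iff_contDiffAt.2 fun ξ => ?_)
  by_cases hξ : ξ = 0
  · refine (contDiffAt_const (c := (1 : ℝ))).congr_of_eventuallyEq ?_
    rw [hξ]
    filter_upwards [Metric.ball_mem_nhds 0 (by norm_num : (0 : ℝ) < 1 / 2)] with y hy
    exact c.eq_one _ ⟨norm_nonneg _, (mem_ball_zero_iff.1 hy).le⟩
  · exact c.smooth.contDiffAt.comp ξ (contDiffAt_norm ℝ hξ)

theorem hasCompactSupport_radialCutoff (c : Cutoff) :
    HasCompactSupport fun ξ : EuclideanSpace ℝ (Fin d) => ((c.χ ‖ξ‖ : ℝ) : ℂ) := by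
  refine .intro (isCompact_closedBall 0 1) fun ξ hξ => ?_
  rw [mem_closedBall_zero_iff, not_le] at hξ
  simp [c.eq_zero _ hξ.le]

/-- The symbol `χ(|ξ|)`, as a Schwartz function. -/
def radialCutoff (d : ℕ) (c : Cutoff) : 𝓢(EuclideanSpace ℝ (Fin d), ℂ) :=
  (hasCompactSupport_radialCutoff c).toSchwartzMap (contDiff_radialCutoff c)

/-- The symbol `ξᵢ χ(|ξ|)`, as a Schwartz function. -/
def coordCutoff (c : Cutoff) (i : Fin d) : 𝓢(EuclideanSpace ℝ (Fin d), ℂ) :=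
  HasCompactSupport.toSchwartzMap
    (f := fun ξ : EuclideanSpace ℝ (Fin d) => ((ξ i : ℝ) : ℂ) * ((c.χ ‖ξ‖ : ℝ) : ℂ))
    (hasCompactSupport_radialCutoff c).mul_left
    ((Complex.ofRealCLM.contDiff.comp (by fun_prop)).mul (contDiff_radialCutoff c))

theorem radialCutoff_apply (c : Cutoff) (ξ : EuclideanSpace ℝ (Fin d)) :
    radialCutoff d c ξ = ((c.χ ‖ξ‖ : ℝ) : ℂ) := rfl

theorem coordCutoff_apply (c : Cutoff) (i : Fin d) (ξ : EuclideanSpace ℝ (Fin d)) :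
    coordCutoff c i ξ = ((ξ i : ℝ) : ℂ) * ((c.χ ‖ξ‖ : ℝ) : ℂ) := rfl

end Multipliers

section Blocks

open scoped FourierTransform

theorem znorm_nonneg (k : Fin d → ℤ) : 0 ≤ znorm k := Real.sqrt_nonneg _

theorem znorm_add_le (k m : Fin d → ℤ) : znorm (k + m) ≤ znorm k + znorm m := by
  simp_rw [← norm_latticePoint]
  refine le_of_eq_of_le (congrArg _ ?_) (norm_add_le _ _)
  ext i
  simp [latticePoint]

theorem znorm_neg (k : Fin d → ℤ) : znorm (-k) = znorm k := by simp [znorm]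

theorem abs_le_znorm (k : Fin d → ℤ) (i : Fin d) : |(k i : ℝ)| ≤ znorm k := by
  rw [← norm_latticePoint]
  exact PiLp.norm_apply_le (latticePoint k) i

theorem finite_znorm_le (r : ℝ) : {k : Fin d → ℤ | znorm k ≤ r}.Finite := by
  refine (Set.finite_Icc (fun _ => -⌈r⌉) (fun _ => ⌈r⌉)).subset fun k hk => ?_
  have h (i : Fin d) : |(k i : ℝ)| ≤ ⌈r⌉ := ((abs_le_znorm k i).trans hk).trans (Int.le_ceil r)
  exact ⟨fun i => by exact_mod_cast (abs_le.1 (h i)).1, fun i => by exact_mod_cast (abs_le.1 (h i)).2⟩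

theorem lpSymb_eq_zero_of_le (c : Cutoff) (j : ℕ) {t : ℝ} (ht : 2 ^ j ≤ t) : lpSymb c j t = 0 := by
  cases j with
  | zero => exact c.eq_zero _ (by simpa using ht)
  | succ j =>
    have h : (2 : ℝ) ^ j ≤ t := (pow_le_pow_right₀ one_le_two j.le_succ).trans ht
    rw [lpSymb, c.eq_zero _ ((one_le_div (by positivity)).2 ht),
      c.eq_zero _ ((one_le_div (by positivity)).2 h), sub_zero]

theorem lpSymb_eq_zero_of_mul_le (c : Cutoff) (j : ℕ) (hj : j ≠ 0) {t : ℝ} (ht0 : 0 ≤ t)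
    (ht : 4 * t ≤ 2 ^ j) : lpSymb c j t = 0 := by
  obtain ⟨j, rfl⟩ := Nat.exists_eq_succ_of_ne_zero hj
  have hp : (0 : ℝ) < 2 ^ j := by positivity
  rw [Nat.succ_eq_add_one, pow_succ] at ht
  rw [lpSymb, c.eq_one, c.eq_one, sub_self]
  · exact ⟨by positivity, by rw [div_le_iff₀ hp]; linarith⟩
  · exact ⟨by positivity, by rw [div_le_iff₀ (by positivity), pow_succ]; linarith⟩

theorem sum_lpSymb (c : Cutoff) (t : ℝ) (n : ℕ) :
    ∑ j ∈ Finset.range (n + 1), lpSymb c j t = c.χ (t / 2 ^ n) := by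
  induction n with
  | zero => simp [lpSymb]
  | succ n ih => rw [Finset.sum_range_succ, ih, lpSymb]; ring

theorem hasSum_lpSymb (c : Cutoff) {t : ℝ} (ht : 0 ≤ t) : HasSum (fun j => lpSymb c j t) 1 := by
  obtain ⟨n, hn⟩ := pow_unbounded_of_one_lt (4 * t) (one_lt_two (α := ℝ))
  have h : ∑ j ∈ Finset.range (n + 1), lpSymb c j t = 1 := by
    rw [sum_lpSymb]
    exact c.eq_one _ ⟨by positivity, by rw [div_le_iff₀ (by positivity)]; linarith⟩
  rw [← h]
  refine hasSum_sum_of_ne_finset_zero fun j hj => lpSymb_eq_zero_of_mul_le c j ?_ ht ?_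
  · rintro rfl; simp at hj
  · rw [Finset.mem_range, not_lt] at hj
    exact hn.le.trans (pow_le_pow_right₀ one_le_two (by omega))

variable [NormedAddCommGroup E] [NormedSpace ℂ E]

theorem znorm_lt_of_blockC_ne_zero {c : Cutoff} {j : ℕ} {a : (Fin d → ℤ) → E} {k : Fin d → ℤ}
    (h : blockC c j a k ≠ 0) : znorm k < 2 ^ j := by
  contrapose! h
  simp [blockC, lpSymb_eq_zero_of_le c j h]

theorem finite_support_blockC (c : Cutoff) (j : ℕ) (a : (Fin d → ℤ) → E) :
    (Function.support (blockC c j a)).Finite :=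
  (finite_znorm_le (2 ^ j)).subset fun _ hk => (znorm_lt_of_blockC_ne_zero hk).le

theorem supNorm_sub_le {a b : (Fin d → ℤ) → E} (ha : (Function.support a).Finite)
    (hb : (Function.support b).Finite) :
    supNorm (fun k => a k - b k) ≤ supNorm a + supNorm b := by
  classical
  refine iSup_le fun x => ?_
  have h : realize (fun k => a k - b k) x = realize a x - realize b x := by
    rw [realize_eq_sum (a := a) (s := ha.toFinset ∪ hb.toFinset) (by simp),
      realize_eq_sum (a := b) (s := ha.toFinset ∪ hb.toFinset) (by simp),
      realize_eq_sum (s := ha.toFinset ∪ hb.toFinset), ← Finset.sum_sub_distrib]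
    · simp_rw [smul_sub]
    · simpa using Function.support_sub a b
  rw [h]
  exact enorm_sub_le.trans
    (add_le_add (enorm_realize_le_supNorm a x) (enorm_realize_le_supNorm b x))

variable [CompleteSpace E]

theorem supNorm_dilated_cutoff_le (c : Cutoff) (j : ℕ) {a : (Fin d → ℤ) → E}
    (ha : (Function.support a).Finite) :
    supNorm (fun k => ((c.χ (znorm k / 2 ^ j) : ℝ) : ℂ) • a k)
      ≤ (∫⁻ y, ‖𝓕 (radialCutoff d c) y‖ₑ) * supNorm a := by
  convert supNorm_multiplier_le (radialCutoff d c) ((2 ^ j)⁻¹) ha using 5 with k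
  rw [radialCutoff_apply, norm_smul, norm_latticePoint, norm_inv, div_eq_inv_mul]
  simp

theorem supNorm_blockC_le (c : Cutoff) (j : ℕ) {a : (Fin d → ℤ) → E}
    (ha : (Function.support a).Finite) :
    supNorm (blockC c j a) ≤ 2 * (∫⁻ y, ‖𝓕 (radialCutoff d c) y‖ₑ) * supNorm a := by
  cases j with
  | zero =>
    have h := supNorm_dilated_cutoff_le c 0 ha
    simp only [pow_zero, div_one] at h
    refine h.trans ?_
    gcongr
    exact le_mul_of_one_le_left' one_le_two
  | succ j =>
    have h : blockC c (j + 1) a = fun k => ((c.χ (znorm k / 2 ^ (j + 1)) : ℝ) : ℂ) • a k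
        - ((c.χ (znorm k / 2 ^ j) : ℝ) : ℂ) • a k := by
      ext1 k
      rw [blockC, lpSymb, Complex.ofReal_sub, sub_smul]
    have hf (f : (Fin d → ℤ) → ℂ) : (Function.support fun k => f k • a k).Finite :=
      ha.subset (Function.support_smul_subset_right f a)
    rw [h, mul_assoc, two_mul]
    exact (supNorm_sub_le (hf _) (hf _)).trans
      (add_le_add (supNorm_dilated_cutoff_le c _ ha) (supNorm_dilated_cutoff_le c _ ha))

/-- Fourier coefficients of the partial derivative `∂ᵢ`. -/
def partialC (i : Fin d) (a : (Fin d → ℤ) → E) : (Fin d → ℤ) → E :=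
  fun k => (((2 * Real.pi : ℝ) : ℂ) * Complex.I * (k i : ℂ)) • a k

/-- Bernstein's inequality for trigonometric polynomials. -/
theorem supNorm_partialC_le (c : Cutoff) (i : Fin d) (j : ℕ) {a : (Fin d → ℤ) → E}
    (ha : ∀ k, a k ≠ 0 → znorm k < 2 ^ j) :
    supNorm (partialC i a)
      ≤ ‖4 * Real.pi‖ₑ * (∫⁻ y, ‖𝓕 (coordCutoff c i) y‖ₑ) * 2 ^ j * supNorm a := by
  have hfin : (Function.support a).Finite :=
    (finite_znorm_le (2 ^ j)).subset fun k hk => (ha k hk).le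
  have h : partialC i a = fun k => (((4 * Real.pi * 2 ^ j : ℝ) : ℂ) * Complex.I) •
      (coordCutoff c i (((2 ^ (j + 1))⁻¹ : ℝ) • latticePoint k) • a k) := by
    ext1 k
    by_cases hk : a k = 0
    · simp [partialC, hk]
    have h1 : c.χ ‖((2 ^ (j + 1))⁻¹ : ℝ) • latticePoint k‖ = 1 := by
      refine c.eq_one _ ⟨norm_nonneg _, ?_⟩
      rw [norm_smul, norm_latticePoint, norm_inv, norm_pow, Real.norm_ofNat,
        inv_mul_le_iff₀ (by positivity), pow_succ]
      linarith [ha k hk]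
    rw [coordCutoff_apply, h1, partialC, smul_smul]
    congr 1
    simp only [latticePoint, PiLp.smul_apply, smul_eq_mul]
    push_cast
    rw [pow_succ]
    field_simp
    ring
  rw [h]
  refine iSup_le fun x => ?_
  have hr (z : ℂ) (b : (Fin d → ℤ) → E) :
      realize (fun k => z • b k) x = z • realize b x := by
    unfold realize
    simp_rw [smul_comm _ z]
    exact tsum_const_smul'' z
  rw [hr, enorm_smul]
  calc _ ≤ (‖4 * Real.pi‖ₑ * 2 ^ j) * ((∫⁻ y, ‖𝓕 (coordCutoff c i) y‖ₑ) * supNorm a) := by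
        refine mul_le_mul' (le_of_eq ?_) ((enorm_realize_le_supNorm _ x).trans
          (supNorm_multiplier_le (coordCutoff c i) _ hfin))
        rw [enorm_mul, ← ofReal_norm, Complex.norm_real, ofReal_norm, enorm_mul, enorm_pow]
        simp [← ofReal_norm]
    _ = _ := by ring

end Blocks

section SequenceInequalities

theorem ENNReal.sq_rpow_half (x : ℝ≥0∞) : (x ^ 2) ^ (1 / 2 : ℝ) = x := by
  rw [← ENNReal.rpow_natCast, ← ENNReal.rpow_mul]
  norm_num

theorem ENNReal.rpow_half_sq (x : ℝ≥0∞) : (x ^ (1 / 2 : ℝ)) ^ 2 = x := by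
  rw [← ENNReal.rpow_natCast, ← ENNReal.rpow_mul]
  norm_num

theorem ENNReal.tsum_mul_sq_le {ι : Type*} (f g : ι → ℝ≥0∞) :
    (∑' i, f i * g i) ^ 2 ≤ (∑' i, f i ^ 2) * ∑' i, g i ^ 2 := by
  let _ : MeasurableSpace ι := ⊤
  have h := ENNReal.lintegral_mul_le_Lp_mul_Lq Measure.count Real.HolderConjugate.two_two
    (measurable_from_top (f := f)).aemeasurable (measurable_from_top (f := g)).aemeasurable
  simp only [lintegral_count, Pi.mul_apply, ENNReal.rpow_two] at h
  calc _ ≤ _ := pow_le_pow_left' h 2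
    _ = _ := by rw [mul_pow, ENNReal.rpow_half_sq, ENNReal.rpow_half_sq]

/-- Schur's test on `ℓ²` for a symmetric kernel. -/
theorem ENNReal.tsum_tsum_mul_sq_le {ι : Type*} (K : ι → ι → ℝ≥0∞) (hK : ∀ i j, K i j = K j i)
    {M : ℝ≥0∞} (hM : ∀ i, ∑' j, K i j ≤ M) (f : ι → ℝ≥0∞) :
    ∑' i, (∑' j, K i j * f j) ^ 2 ≤ M ^ 2 * ∑' j, f j ^ 2 := by
  have h (i : ι) : (∑' j, K i j * f j) ^ 2 ≤ M * ∑' j, K i j * f j ^ 2 := by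
    have h1 := ENNReal.tsum_mul_sq_le (fun j => K i j ^ (1 / 2 : ℝ))
      (fun j => K i j ^ (1 / 2 : ℝ) * f j)
    simp only [mul_pow, ENNReal.rpow_half_sq, ← mul_assoc, ← sq] at h1
    exact h1.trans (by gcongr; exact hM i)
  calc _ ≤ ∑' i, M * ∑' j, K i j * f j ^ 2 := ENNReal.tsum_le_tsum h
    _ = M * ∑' j, (∑' i, K i j) * f j ^ 2 := by
      rw [ENNReal.tsum_mul_left, ENNReal.tsum_comm]
      simp_rw [ENNReal.tsum_mul_right]
    _ ≤ M * ∑' j, M * f j ^ 2 := by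
      gcongr with j
      simp_rw [fun i => hK i j]
      exact hM j
    _ = _ := by rw [ENNReal.tsum_mul_left, ← mul_assoc, sq]

theorem lr_two (a : ℕ → ℝ≥0∞) : lr 2 a = (∑' j, a j ^ 2) ^ (1 / 2 : ℝ) := by
  simp [lr]

theorem le_lr_two (a : ℕ → ℝ≥0∞) (j : ℕ) : a j ≤ lr 2 a := by
  rw [lr_two, ← ENNReal.sq_rpow_half (a j)]
  gcongr
  exact ENNReal.le_tsum j

theorem tsum_band_le (q n : ℕ) (x : ℝ≥0∞) :
    ∑' j : ℕ, (if j ≤ q + n ∧ q ≤ j + n then x else 0) ≤ (2 * n + 1) * x := by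
  rw [tsum_eq_sum (s := Finset.Icc (q - n) (q + n))]
  · refine (Finset.sum_le_sum fun j _ => (ite_le_sup _ _ _).trans (by simp)
      : _ ≤ ∑ _ ∈ Finset.Icc (q - n) (q + n), x).trans ?_
    rw [Finset.sum_const, nsmul_eq_mul]
    gcongr
    rw [Nat.card_Icc]
    exact_mod_cast (by omega : q + n + 1 - (q - n) ≤ 2 * n + 1)
  · intro j hj
    rw [Finset.mem_Icc, not_and_or] at hj
    exact if_neg (by omega)

/-- A band matrix whose `l`-th band has width comparable to `l` and weight `w l`. -/
def bandKernel (w : ℕ → ℝ≥0∞) (q j : ℕ) : ℝ≥0∞ :=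
  ∑' l : ℕ, if j ≤ q + (l + 2) ∧ q ≤ j + (l + 2) then w l else 0

theorem bandKernel_comm (w : ℕ → ℝ≥0∞) (q j : ℕ) : bandKernel w q j = bandKernel w j q := by
  unfold bandKernel
  simp_rw [and_comm]

theorem tsum_bandKernel_le (w : ℕ → ℝ≥0∞) (q : ℕ) :
    ∑' j, bandKernel w q j ≤ ∑' l : ℕ, (2 * l + 5) * w l := by
  unfold bandKernel
  rw [ENNReal.tsum_comm]
  refine ENNReal.tsum_le_tsum fun l => (tsum_band_le q (l + 2) (w l)).trans (le_of_eq ?_)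
  push_cast
  ring

theorem tsum_geometric_weight_ne_top {ε : ℝ} (hε : 0 < ε) :
    ∑' l : ℕ, (2 * (l : ℝ≥0∞) + 5) * 2 ^ (-((l : ℝ) * ε)) ≠ ∞ := by
  have hr : ‖(2 : ℝ) ^ (-ε)‖ < 1 := by
    rw [Real.norm_of_nonneg (by positivity)]
    exact Real.rpow_lt_one_of_one_lt_of_neg one_lt_two (by linarith)
  have h0 := summable_geometric_of_norm_lt_one hr
  have h1 := summable_pow_mul_geometric_of_norm_lt_one 1 hr
  have h := ((h1.mul_left 2).add (h0.mul_left 5)).tsum_ofReal_ne_top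
  convert h using 3 with l
  have e : (2 * (l : ℝ) + 5) * ((2 : ℝ) ^ (-ε)) ^ l
      = 2 * (↑l ^ 1 * (2 ^ (-ε)) ^ l) + 5 * (2 ^ (-ε)) ^ l := by ring
  rw [← e, ENNReal.ofReal_mul (by positivity), ← Real.rpow_natCast (2 ^ (-ε)) l,
    ← Real.rpow_mul zero_le_two,
    ← ENNReal.ofReal_rpow_of_pos two_pos]
  congr 1
  · rw [ENNReal.ofReal_add (by positivity) (by positivity), ENNReal.ofReal_mul zero_le_two]
    simp
  · rw [ENNReal.ofReal_ofNat]
    congr 1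
    ring

end SequenceInequalities

section Advection

theorem enorm_le_of_forall_enorm_apply_le {f : Fin d → ℂ} {M : ℝ≥0∞} (h : ∀ i, ‖f i‖ₑ ≤ M) :
    ‖f‖ₑ ≤ M := by
  by_cases hM : M = ∞
  · exact hM ▸ le_top
  lift M to ℝ≥0 using hM
  simp only [enorm_eq_nnnorm, ENNReal.coe_le_coe] at h ⊢
  exact (pi_nnnorm_le_iff).2 h

theorem enorm_apply_le_enorm (f : Fin d → ℂ) (i : Fin d) : ‖f i‖ₑ ≤ ‖f‖ₑ := by
  simpa only [enorm_eq_nnnorm, ENNReal.coe_le_coe] using nnnorm_le_pi_nnnorm f i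

theorem realize_apply {a : VC d} (ha : (Function.support a).Finite) (x : Fin d → ℝ) (i : Fin d) :
    realize a x i = ∑' k, fChar k x * a k i := by
  rw [realize_eq_sum (s := ha.toFinset) (by simp), tsum_eq_sum (s := ha.toFinset)]
  · simp
  · intro k hk
    have : a k = 0 := by simpa using hk
    simp [this]

/-- Bessel's inequality for a component of a vector-valued trigonometric polynomial. -/
theorem tsum_enorm_apply_sq_le {a : VC d} (ha : (Function.support a).Finite) (i : Fin d) :
    ∑' k, ‖a k i‖ₑ ^ 2 ≤ supNorm a ^ 2 := by
  by_cases hM : supNorm a = ∞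
  · simp [hM]
  obtain ⟨M, hM'⟩ : ∃ M : ℝ≥0, (M : ℝ≥0∞) = supNorm a := ⟨_, ENNReal.coe_toNNReal hM⟩
  have hB := sum_norm_sq_le_of_bound (a := fun k => a k i) ha.toFinset (M := M) fun x => by
    have h := (enorm_apply_le_enorm _ i).trans (enorm_realize_le_supNorm a x)
    rw [← hM', enorm_eq_nnnorm, ENNReal.coe_le_coe, realize_eq_sum (s := ha.toFinset) (by simp)] at h
    simpa using NNReal.coe_le_coe.2 h
  rw [tsum_eq_sum (s := ha.toFinset)]
  · rw [← hM']
    simp only [enorm_eq_nnnorm]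
    norm_cast
    rw [← NNReal.coe_le_coe]
    push_cast
    simpa using hB
  · intro k hk
    have : a k = 0 := by simpa using hk
    simp [this]

/-- The summand of the convolution defining `advect`. -/
def advectTerm (a b : VC d) (k : Fin d → ℤ) (i : Fin d) (m : Fin d → ℤ) : ℂ :=
  (∑ l, a m l * (((2 * Real.pi : ℝ) : ℂ) * Complex.I * ((k l - m l : ℤ) : ℂ))) * b (k - m) i

theorem advect_apply (a b : VC d) (k : Fin d → ℤ) (i : Fin d) :
    advect a b k i = ∑' m, advectTerm a b k i m := rfl

theorem advectTerm_eq (a b : VC d) (k : Fin d → ℤ) (i : Fin d) (m : Fin d → ℤ) :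
    advectTerm a b k i m = ∑ l, a m l * partialC l b (k - m) i := by
  rw [advectTerm, Finset.sum_mul]
  refine Finset.sum_congr rfl fun l _ => ?_
  simp only [partialC, Pi.smul_apply, smul_eq_mul, Pi.sub_apply]
  ring

theorem ne_zero_of_advectTerm_ne_zero {a b : VC d} {k : Fin d → ℤ} {i : Fin d} {m : Fin d → ℤ}
    (h : advectTerm a b k i m ≠ 0) : a m ≠ 0 ∧ b (k - m) ≠ 0 := by
  constructor <;> intro h0 <;> exact h (by simp [advectTerm, h0])

theorem finite_support_advect {a b : VC d} (ha : (Function.support a).Finite)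
    (hb : (Function.support b).Finite) : (Function.support (advect a b)).Finite := by
  refine ((ha.prod hb).image fun p => p.1 + p.2).subset fun k hk => ?_
  obtain ⟨i, hi⟩ := Function.ne_iff.1 hk
  rw [advect_apply] at hi
  obtain ⟨m, hm⟩ : ∃ m, advectTerm a b k i m ≠ 0 := by
    by_contra! h
    exact hi (by simp [h])
  exact ⟨(m, k - m), ne_zero_of_advectTerm_ne_zero hm, by simp⟩

theorem HasSum.comp_sub_right {G α : Type*} [AddGroup G] [AddCommMonoid α] [TopologicalSpace α]
    {f : G → α} {s : α} (h : HasSum f s) (m : G) : HasSum (fun k => f (k - m)) s :=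
  (Equiv.hasSum_iff (f := f) (Equiv.subRight m)).2 h

theorem fChar_mul_advect {a b : VC d} (ha : (Function.support a).Finite) (x : Fin d → ℝ)
    (k : Fin d → ℤ) (i : Fin d) :
    fChar k x * advect a b k i = ∑ m ∈ ha.toFinset, ∑ l, fChar m x * a m l *
      (fChar (k - m) x * partialC l b (k - m) i) := by
  rw [advect_apply, tsum_eq_sum (s := ha.toFinset), Finset.mul_sum]
  · refine Finset.sum_congr rfl fun m _ => ?_
    rw [advectTerm_eq, Finset.mul_sum]
    refine Finset.sum_congr rfl fun l _ => ?_
    have : fChar k x = fChar m x * fChar (k - m) x := by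
      rw [← fChar_add_freq, add_sub_cancel]
    rw [this]
    ring
  · intro m hm
    have : a m = 0 := by simpa using hm
    simp [advectTerm, this]

theorem realize_advect {a b : VC d} (ha : (Function.support a).Finite)
    (hb : (Function.support b).Finite) (x : Fin d → ℝ) (i : Fin d) :
    realize (advect a b) x i = ∑ l, realize a x l * realize (partialC l b) x i := by
  have hbl (l : Fin d) : (Function.support (partialC l b)).Finite :=
    hb.subset fun k hk h => hk (by simp [partialC, h])
  have hs (l : Fin d) (m : Fin d → ℤ) : HasSum
      (fun k => fChar (k - m) x * partialC l b (k - m) i) (realize (partialC l b) x i) := by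
    have h : Summable fun n => fChar n x * partialC l b n i := by
      refine summable_of_hasFiniteSupport ((hbl l).subset fun n hn h => hn ?_)
      simp [h]
    rw [realize_apply (hbl l)]
    exact h.hasSum.comp_sub_right m
  have hadv : HasSum (fun k => fChar k x * advect a b k i) (∑ m ∈ ha.toFinset, ∑ l,
      fChar m x * a m l * realize (partialC l b) x i) := by
    simp_rw [fChar_mul_advect ha]
    exact hasSum_sum fun m _ => hasSum_sum fun l _ => (hs l m).mul_left _
  rw [realize_apply (finite_support_advect ha hb), hadv.tsum_eq, Finset.sum_comm]
  refine Finset.sum_congr rfl fun l _ => ?_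
  rw [← Finset.sum_mul, realize_eq_sum (a := a) (s := ha.toFinset) (by simp), Finset.sum_apply]
  rfl

/-- The constant in the bound for the advection of one Littlewood–Paley block by another. -/
def advectConst (d : ℕ) (c : Cutoff) : ℝ≥0∞ :=
  ∑ l : Fin d, ‖4 * Real.pi‖ₑ * ∫⁻ y, ‖FourierTransform.fourier (coordCutoff c l) y‖ₑ

theorem advectConst_ne_top (d : ℕ) (c : Cutoff) : advectConst d c ≠ ∞ :=
  ENNReal.sum_ne_top.2 fun _ _ =>
    ENNReal.mul_ne_top enorm_ne_top (lintegral_enorm_fourier_lt_top _).ne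

theorem supNorm_advect_le (c : Cutoff) (j : ℕ) {a b : VC d} (ha : (Function.support a).Finite)
    (hb : ∀ k, b k ≠ 0 → znorm k < 2 ^ j) :
    supNorm (advect a b) ≤ advectConst d c * (supNorm a * (2 ^ j * supNorm b)) := by
  have hbf : (Function.support b).Finite :=
    (finite_znorm_le (2 ^ j)).subset fun k hk => (hb k hk).le
  refine iSup_le fun x => enorm_le_of_forall_enorm_apply_le fun i => ?_
  rw [realize_advect ha hbf, advectConst, Finset.sum_mul]
  refine (enorm_sum_le _ _).trans (Finset.sum_le_sum fun l _ => ?_)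
  rw [enorm_mul]
  calc _ ≤ supNorm a * supNorm (partialC l b) := by
        gcongr
        · exact (enorm_apply_le_enorm _ l).trans (enorm_realize_le_supNorm a x)
        · exact (enorm_apply_le_enorm _ i).trans (enorm_realize_le_supNorm _ x)
    _ ≤ supNorm a * (_ * supNorm b) := by gcongr; exact supNorm_partialC_le c l j hb
    _ = _ := by ring

theorem tsum_enorm_advectTerm_le (j : ℕ) {a b : VC d} (ha : (Function.support a).Finite)
    (hb : ∀ k, b k ≠ 0 → znorm k < 2 ^ j) (k : Fin d → ℤ) (i : Fin d) :
    ∑' m, ‖advectTerm a b k i m‖ₑ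
      ≤ d * ‖2 * Real.pi‖ₑ * (supNorm a * (2 ^ j * supNorm b)) := by
  have hbf : (Function.support b).Finite :=
    (finite_znorm_le (2 ^ j)).subset fun k hk => (hb k hk).le
  have hpt (m : Fin d → ℤ) : ‖advectTerm a b k i m‖ₑ
      ≤ ∑ l, ‖2 * Real.pi‖ₑ * 2 ^ j * (‖a m l‖ₑ * ‖b (k - m) i‖ₑ) := by
    rw [advectTerm_eq]
    refine (enorm_sum_le _ _).trans (Finset.sum_le_sum fun l _ => ?_)
    rw [partialC, Pi.smul_apply, smul_eq_mul, enorm_mul, enorm_mul]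
    by_cases h0 : b (k - m) i = 0
    · simp [h0]
    have hz : ‖((2 * Real.pi : ℝ) : ℂ) * Complex.I * (((k - m) l : ℤ) : ℂ)‖ₑ
        ≤ ‖2 * Real.pi‖ₑ * 2 ^ j := by
      rw [enorm_mul, enorm_mul, ← ofReal_norm ((2 * Real.pi : ℝ) : ℂ), Complex.norm_real,
        ofReal_norm, ← ofReal_norm Complex.I, Complex.norm_I, ENNReal.ofReal_one, mul_one]
      gcongr
      rw [← ofReal_norm, Complex.norm_intCast]
      refine (ENNReal.ofReal_le_ofReal ((abs_le_znorm (k - m) l).trans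
        (hb _ fun h => h0 (by simp [h])).le)).trans (le_of_eq ?_)
      rw [ENNReal.ofReal_pow zero_le_two, ENNReal.ofReal_ofNat]
    calc _ ≤ ‖a m l‖ₑ * (‖2 * Real.pi‖ₑ * 2 ^ j * ‖b (k - m) i‖ₑ) := by gcongr
      _ = _ := by ring
  have hcs (l : Fin d) : ∑' m, ‖a m l‖ₑ * ‖b (k - m) i‖ₑ ≤ supNorm a * supNorm b := by
    rw [← ENNReal.sq_rpow_half (∑' m, _), ← ENNReal.sq_rpow_half (supNorm a * supNorm b)]
    refine ENNReal.rpow_le_rpow ?_ (by norm_num)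
    refine (ENNReal.tsum_mul_sq_le _ _).trans ?_
    rw [mul_pow]
    gcongr
    · exact tsum_enorm_apply_sq_le ha l
    · exact ((Equiv.subLeft k).tsum_eq fun n => ‖b n i‖ₑ ^ 2).trans_le
        (tsum_enorm_apply_sq_le hbf i)
  calc _ ≤ ∑' m, ∑ l, ‖2 * Real.pi‖ₑ * 2 ^ j * (‖a m l‖ₑ * ‖b (k - m) i‖ₑ) :=
        ENNReal.tsum_le_tsum hpt
    _ = ∑ l, ‖2 * Real.pi‖ₑ * 2 ^ j * ∑' m, ‖a m l‖ₑ * ‖b (k - m) i‖ₑ := by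
        rw [Summable.tsum_finsetSum fun _ _ => ENNReal.summable]
        simp_rw [ENNReal.tsum_mul_left]
    _ ≤ ∑ _l : Fin d, ‖2 * Real.pi‖ₑ * 2 ^ j * (supNorm a * supNorm b) := by
        gcongr with l; exact hcs l
    _ = _ := by
        rw [Finset.sum_const, nsmul_eq_mul, Finset.card_univ, Fintype.card_fin]
        ring

end Advection

section ProductRule

open scoped FourierTransform

/-- Frequency localization of the interaction of two Littlewood–Paley blocks. -/
theorem band_of_advectTerm_ne_zero {c : Cutoff} {u v : VC d} {q j l : ℕ} {k m : Fin d → ℤ}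
    {i : Fin d} (hq : lpSymb c q (znorm k) ≠ 0)
    (h : advectTerm (blockC c j u) (blockC c l v) k i m ≠ 0) :
    j ≤ q + (l + 2) ∧ q ≤ j + (l + 2) := by
  obtain ⟨hu, hv⟩ := ne_zero_of_advectTerm_ne_zero h
  have hj : lpSymb c j (znorm m) ≠ 0 := fun h0 => hu (by simp [blockC, h0])
  have hl := znorm_lt_of_blockC_ne_zero hv
  have aux {x y : ℕ} {r s : Fin d → ℤ} (hx : lpSymb c x (znorm r) ≠ 0)
      (hy : lpSymb c y (znorm s) ≠ 0) (hrs : znorm r ≤ znorm s + znorm (k - m)) :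
      x ≤ y + (l + 2) := by
    by_contra! hlt
    refine hx (lpSymb_eq_zero_of_mul_le c x (by omega) (znorm_nonneg r) ?_)
    have hs : znorm s < 2 ^ y := by
      by_contra! hge
      exact hy (lpSymb_eq_zero_of_le c y hge)
    have h1 : (2 : ℝ) ^ y ≤ 2 ^ (y + l) := pow_le_pow_right₀ one_le_two (by omega)
    have h2 : (2 : ℝ) ^ l ≤ 2 ^ (y + l) := pow_le_pow_right₀ one_le_two (by omega)
    have h3 : (2 : ℝ) ^ (y + l + 3) ≤ 2 ^ x := pow_le_pow_right₀ one_le_two (by omega)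
    have h4 : (2 : ℝ) ^ (y + l + 3) = 8 * 2 ^ (y + l) := by ring
    linarith
  refine ⟨aux hj hq ?_, aux hq hj ?_⟩
  · have := znorm_add_le k (-(k - m))
    rwa [znorm_neg, ← sub_eq_add_neg, sub_sub_cancel] at this
  · simpa using znorm_add_le m (k - m)

theorem hasSum_advectTerm_blockC (c : Cutoff) (u v : VC d) (k m : Fin d → ℤ) (i : Fin d) :
    HasSum (fun p : ℕ × ℕ => advectTerm (blockC c p.1 u) (blockC c p.2 v) k i m)
      (advectTerm u v k i m) := by
  have h1 := hasSum_lpSymb c (znorm_nonneg m)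
  have h2 := hasSum_lpSymb c (znorm_nonneg (k - m))
  have h12 := h1.mul h2 (summable_mul_of_summable_norm h1.summable.norm h2.summable.norm)
  have h := (Complex.hasSum_ofReal.2 h12).mul_right (advectTerm u v k i m)
  rw [mul_one, Complex.ofReal_one, one_mul] at h
  have e : (fun p : ℕ × ℕ => advectTerm (blockC c p.1 u) (blockC c p.2 v) k i m) = fun p =>
      ((lpSymb c p.1 (znorm m) * lpSymb c p.2 (znorm (k - m)) : ℝ) : ℂ) *
        advectTerm u v k i m := by
    ext p
    simp only [advectTerm, blockC, Pi.smul_apply, smul_eq_mul, Complex.ofReal_mul, Finset.sum_mul,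
      Finset.mul_sum]
    exact Finset.sum_congr rfl fun n _ => by ring
  exact e ▸ h

/-- The sum of the products of the sizes of the blocks of `u` and of the gradient of `v` whose
interaction can reach the frequencies of the block `q`. -/
def bandSum (U V : ℕ → ℝ≥0∞) (q : ℕ) : ℝ≥0∞ :=
  ∑' p : ℕ × ℕ, if p.1 ≤ q + (p.2 + 2) ∧ q ≤ p.1 + (p.2 + 2)
    then U p.1 * (2 ^ p.2 * V p.2) else 0

theorem hasSum_blockC_advect (c : Cutoff) (u v : VC d) (q : ℕ) (k : Fin d → ℤ)
    (hfin : bandSum (fun j => supNorm (blockC c j u)) (fun l => supNorm (blockC c l v)) q ≠ ∞) :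
    HasSum (fun p : ℕ × ℕ => blockC c q (advect (blockC c p.1 u) (blockC c p.2 v)) k)
      (blockC c q (advect u v) k) := by
  by_cases hq : lpSymb c q (znorm k) = 0
  · simp only [blockC, hq, Complex.ofReal_zero, zero_smul]
    exact hasSum_zero
  refine HasSum.const_smul _ (Pi.hasSum.2 fun i => ?_)
  simp only [advect_apply]
  set T : ℕ × ℕ → (Fin d → ℤ) → ℂ := fun p m =>
    advectTerm (blockC c p.1 u) (blockC c p.2 v) k i m with hT
  have hsum : Summable (Function.uncurry T) := by
    refine Summable.of_enorm ?_
    rw [ENNReal.tsum_prod']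
    have hle : ∑' p, ∑' m, ‖T p m‖ₑ ≤ d * ‖2 * Real.pi‖ₑ *
        bandSum (fun j => supNorm (blockC c j u)) (fun l => supNorm (blockC c l v)) q := by
      rw [bandSum, ← ENNReal.tsum_mul_left]
      refine ENNReal.tsum_le_tsum fun p => ?_
      split_ifs with hp
      · exact tsum_enorm_advectTerm_le p.2 (finite_support_blockC c p.1 u)
          (fun _ => znorm_lt_of_blockC_ne_zero) k i
      · refine (ENNReal.tsum_eq_zero.2 fun m => enorm_eq_zero.2 ?_).trans_le zero_le
        by_contra h0
        exact hp (band_of_advectTerm_ne_zero hq h0)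
    refine ne_top_of_le_ne_top ?_ hle
    exact ENNReal.mul_ne_top (ENNReal.mul_ne_top (ENNReal.natCast_ne_top d) enorm_ne_top) hfin
  have hcomm := hsum.tsum_comm
  simp_rw [hT, (hasSum_advectTerm_blockC c u v k _ i).tsum_eq] at hcomm
  rw [hcomm]
  exact hsum.prod.hasSum

/-- The constant in the bound for a Littlewood–Paley block of the advection term. -/
def productConst (d : ℕ) (c : Cutoff) : ℝ≥0∞ :=
  2 * (∫⁻ y, ‖𝓕 (radialCutoff d c) y‖ₑ) * advectConst d c + 1

theorem productConst_ne_top (d : ℕ) (c : Cutoff) : productConst d c ≠ ∞ :=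
  ENNReal.add_ne_top.2 ⟨ENNReal.mul_ne_top (ENNReal.mul_ne_top ENNReal.ofNat_ne_top
    (lintegral_enorm_fourier_lt_top _).ne) (advectConst_ne_top d c), ENNReal.one_ne_top⟩

theorem supNorm_blockC_advect_le (c : Cutoff) (u v : VC d) (q : ℕ) :
    supNorm (blockC c q (advect u v)) ≤ productConst d c *
      bandSum (fun j => supNorm (blockC c j u)) (fun l => supNorm (blockC c l v)) q := by
  by_cases hfin :
      bandSum (fun j => supNorm (blockC c j u)) (fun l => supNorm (blockC c l v)) q = ∞
  · rw [hfin, ENNReal.mul_top (by simp [productConst])]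
    exact le_top
  have hs (w : VC d) : Function.support (blockC c q w)
      ⊆ (finite_znorm_le (d := d) (2 ^ q)).toFinset := fun k hk => by
    simpa using (znorm_lt_of_blockC_ne_zero hk).le
  refine (supNorm_le_tsum (hs _) (fun p => hs _)
    fun k => hasSum_blockC_advect c u v q k hfin).trans ?_
  rw [bandSum, ← ENNReal.tsum_mul_left]
  refine ENNReal.tsum_le_tsum fun p => ?_
  have hu := finite_support_blockC c p.1 u
  split_ifs with hp
  · refine (supNorm_blockC_le c q
      (finite_support_advect hu (finite_support_blockC c p.2 v))).trans ?_
    rw [productConst, add_mul, mul_assoc (2 * _)]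
    refine le_add_right ?_
    gcongr
    exact supNorm_advect_le c p.2 hu fun _ => znorm_lt_of_blockC_ne_zero
  · have h0 : blockC c q (advect (blockC c p.1 u) (blockC c p.2 v)) = 0 := by
      ext k i
      by_cases hq : lpSymb c q (znorm k) = 0
      · simp [blockC, hq]
      have hz (m : Fin d → ℤ) : advectTerm (blockC c p.1 u) (blockC c p.2 v) k i m = 0 := by
        by_contra h0
        exact hp (band_of_advectTerm_ne_zero hq h0)
      simp [blockC, advect_apply, hz]
    simp [h0, supNorm, realize]

end ProductRule

section Besov

theorem besov_top_two [NormedAddCommGroup E] [NormedSpace ℂ E] (c : Cutoff) (s : ℝ)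
    (a : (Fin d → ℤ) → E) : besov c s ∞ 2 a =
      lr 2 fun j => (2 : ℝ≥0∞) ^ ((j : ℝ) * s) * supNorm (blockC c j a) := by
  simp only [besov, tLp_top_eq_supNorm (finite_support_blockC c _ a)]

theorem besov_zero_top_two [NormedAddCommGroup E] [NormedSpace ℂ E] (c : Cutoff)
    (a : (Fin d → ℤ) → E) : besov c 0 ∞ 2 a =
      (∑' j, supNorm (blockC c j a) ^ 2) ^ (1 / 2 : ℝ) := by
  simp [besov_top_two, lr_two]

theorem two_pow_mul_supNorm_blockC_le [NormedAddCommGroup E] [NormedSpace ℂ E] (c : Cutoff)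
    (ε : ℝ) (l : ℕ) (a : (Fin d → ℤ) → E) :
    2 ^ l * supNorm (blockC c l a) ≤
      (2 : ℝ≥0∞) ^ (-((l : ℝ) * ε)) * besov c (1 + ε) ∞ 2 a := by
  have h := le_lr_two (fun j : ℕ => (2 : ℝ≥0∞) ^ ((j : ℝ) * (1 + ε)) * supNorm (blockC c j a)) l
  rw [← besov_top_two] at h
  refine le_trans (le_of_eq ?_) (mul_le_mul_right h _)
  rw [← mul_assoc, ← ENNReal.rpow_add _ _ two_ne_zero ENNReal.ofNat_ne_top,
    ← ENNReal.rpow_natCast]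
  congr 2
  ring

theorem bandSum_le {U V w : ℕ → ℝ≥0∞} {B : ℝ≥0∞} (h : ∀ l, 2 ^ l * V l ≤ w l * B) (q : ℕ) :
    bandSum U V q ≤ B * ∑' j, bandKernel w q j * U j := by
  rw [bandSum, ENNReal.tsum_prod', ← ENNReal.tsum_mul_left]
  refine ENNReal.tsum_le_tsum fun j => ?_
  rw [bandKernel, ← ENNReal.tsum_mul_right, ← ENNReal.tsum_mul_left]
  refine ENNReal.tsum_le_tsum fun l => ?_
  dsimp only
  split_ifs
  · calc U j * (2 ^ l * V l) ≤ U j * (w l * B) := mul_le_mul_right (h l) _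
      _ = B * (w l * U j) := by ring
  · simp

theorem besov_advect_le (c : Cutoff) (ε : ℝ) (u v : VC d) :
    besov c 0 ∞ 2 (advect u v) ≤
      productConst d c * (∑' l : ℕ, (2 * (l : ℝ≥0∞) + 5) * 2 ^ (-((l : ℝ) * ε))) *
        besov c 0 ∞ 2 u * besov c (1 + ε) ∞ 2 v := by
  set w : ℕ → ℝ≥0∞ := fun l => 2 ^ (-((l : ℝ) * ε))
  set M := ∑' l : ℕ, (2 * (l : ℝ≥0∞) + 5) * w l
  set K := productConst d c
  set B := besov c (1 + ε) ∞ 2 v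
  have hblock (q : ℕ) : supNorm (blockC c q (advect u v)) ≤
      K * B * ∑' j, bandKernel w q j * supNorm (blockC c j u) := by
    refine (supNorm_blockC_advect_le c u v q).trans ?_
    rw [mul_assoc]
    gcongr
    exact bandSum_le (fun l => two_pow_mul_supNorm_blockC_le c ε l v) q
  have hsq : ∑' q, supNorm (blockC c q (advect u v)) ^ 2 ≤
      (K * B * M) ^ 2 * ∑' j, supNorm (blockC c j u) ^ 2 := by
    calc _ ≤ ∑' q, (K * B) ^ 2 * (∑' j, bandKernel w q j * supNorm (blockC c j u)) ^ 2 :=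
          ENNReal.tsum_le_tsum fun q => by rw [← mul_pow]; gcongr; exact hblock q
      _ ≤ (K * B) ^ 2 * (M ^ 2 * ∑' j, supNorm (blockC c j u) ^ 2) := by
          rw [ENNReal.tsum_mul_left]
          gcongr
          exact ENNReal.tsum_tsum_mul_sq_le _ (bandKernel_comm w) (tsum_bandKernel_le w) _
      _ = _ := by ring
  rw [besov_zero_top_two, besov_zero_top_two]
  refine (ENNReal.rpow_le_rpow hsq (by norm_num)).trans (le_of_eq ?_)
  rw [ENNReal.mul_rpow_of_nonneg _ _ (by norm_num), ENNReal.sq_rpow_half]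
  ring

end Besov

/-- **Second product rule, in `B^0_{∞,2}`.**  For every `ε > 0` there is a constant
`C_ε > 0` such that for vector fields `u, v` on `𝕋^d`,
`‖u·∇v‖_{B^0_{∞,2}} ≤ C_ε ‖u‖_{B^0_{∞,2}} ‖v‖_{B^{1+ε}_{∞,2}}`. -/
theorem product_rule_B02 (d : ℕ) (c : Cutoff) (ε : ℝ) (hε : 0 < ε) :
    ∃ C : ℝ≥0, 0 < C ∧
      ∀ u v : VC d,
        besov c 0 ∞ 2 (advect u v) ≤
          (C : ℝ≥0∞) * besov c 0 ∞ 2 u * besov c (1 + ε) ∞ 2 v := by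
  obtain ⟨C, hC⟩ : ∃ C : ℝ≥0, (C : ℝ≥0∞) = productConst d c *
      ∑' l : ℕ, (2 * (l : ℝ≥0∞) + 5) * 2 ^ (-((l : ℝ) * ε)) :=
    ⟨_, ENNReal.coe_toNNReal
      (ENNReal.mul_ne_top (productConst_ne_top d c) (tsum_geometric_weight_ne_top hε))⟩
  refine ⟨C + 1, by positivity, fun u v => (besov_advect_le c ε u v).trans ?_⟩
  rw [← hC]
  gcongr
  exact le_self_add
end
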